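/- arXiv:1403.2949 — 2 statements merged into one kernel-verified Lean document; each statement's English description precedes it below -/
import Mathlib

section
/- If N > 30 is an integer, then φ(N) > N / (3 · log log N), where φ denotes Euler's totient function and log is the natural logarithm. -/
set_option exponentiation.threshold 200000

namespace TLB
open Real

/-- primes up to `n` -/
def P (n : ℕ) : Finset ℕ := (Finset.range (n + 1)).filter Nat.Prime

noncomputable def f (p : ℕ) : ℝ := -log (1 - 1 / (p : ℝ))

lemma f_le {p : ℕ} (hp : 2 ≤ p) : f p ≤ 1 / ((p : ℝ) - 1) := by
  have h2 : (2 : ℝ) ≤ p := by exact_mod_cast hp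
  have h0 : 0 < 1 - 1 / (p : ℝ) := by
    have : 1 / (p : ℝ) ≤ 1 / 2 := one_div_le_one_div_of_le (by norm_num) h2
    linarith
  have := one_sub_inv_le_log_of_pos h0
  have e : 1 - (1 - 1 / (p : ℝ))⁻¹ = - (1 / ((p : ℝ) - 1)) := by
    have : (p : ℝ) - 1 ≠ 0 := by linarith
    have : (p : ℝ) ≠ 0 := by linarith
    field_simp
    ring
  unfold f
  linarith

lemma le_f {p : ℕ} (hp : 2 ≤ p) : 1 / (p : ℝ) ≤ f p := by
  have h2 : (2 : ℝ) ≤ p := by exact_mod_cast hp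
  have h0 : 0 < 1 - 1 / (p : ℝ) := by
    have : 1 / (p : ℝ) ≤ 1 / 2 := one_div_le_one_div_of_le (by norm_num) h2
    linarith
  have := log_le_sub_one_of_pos h0
  unfold f
  linarith

lemma mem_P {p n : ℕ} : p ∈ P n ↔ p ≤ n ∧ p.Prime := by
  simp [P]

lemma log_ratio (N : ℕ) (hN : 0 < N) :
    log ((N : ℝ) / N.totient) = ∑ p ∈ N.primeFactors, f p := by
  have h := Nat.totient_eq_mul_prod_factors N
  have h' : ((N.totient : ℕ) : ℝ) = N * ∏ p ∈ N.primeFactors, (1 - 1 / (p : ℝ)) := by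
    have := congrArg (fun q : ℚ => (q : ℝ)) h
    push_cast at this
    simpa using this
  have hpos : ∀ p ∈ N.primeFactors, 1 - 1 / (p : ℝ) ≠ 0 := by
    intro p hp
    have h2 : (2 : ℝ) ≤ p := by exact_mod_cast (Nat.prime_of_mem_primeFactors hp).two_le
    have : 1 / (p : ℝ) ≤ 1 / 2 := one_div_le_one_div_of_le (by norm_num) h2
    linarith
  have hN' : (N : ℝ) ≠ 0 := by positivity
  have ht : (N.totient : ℝ) ≠ 0 := by
    have := Nat.totient_pos.2 hN
    positivity
  rw [log_div hN' ht, h', log_mul hN' (Finset.prod_ne_zero_iff.2 hpos), log_prod hpos]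
  simp [f]

lemma keyA (N y : ℕ) (hN : 0 < N) (hy : 2 ≤ y) :
    log ((N : ℝ) / N.totient) ≤ ∑ p ∈ P y, f p
      + (log N - ∑ p ∈ P y, log (p : ℝ)) / (y * log (y + 1)) := by
  have hyR : (2 : ℝ) ≤ y := by exact_mod_cast hy
  have hl : 0 < log ((y : ℝ) + 1) := log_pos (by linarith)
  set c : ℝ := 1 / (y * log (y + 1)) with hc
  have hc0 : 0 < c := by positivity
  rw [log_ratio N hN]
  have h1 : ∑ p ∈ N.primeFactors, log (p : ℝ) ≤ log N := by
    rw [← log_prod (fun p hp => by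
      have := (Nat.prime_of_mem_primeFactors hp).pos
      positivity)]
    apply log_le_log
    · apply Finset.prod_pos
      intro p hp
      have := (Nat.prime_of_mem_primeFactors hp).pos
      positivity
    · rw [← Nat.cast_prod]
      exact_mod_cast Nat.le_of_dvd hN (Nat.prod_primeFactors_dvd N)
  have h2 : ∑ p ∈ N.primeFactors, (f p - c * log p) ≤ ∑ p ∈ P y, (f p - c * log p) := by
    have hs : N.primeFactors.filter (· ≤ y) ⊆ P y := by
      intro p hp
      rw [Finset.mem_filter] at hp
      exact mem_P.2 ⟨hp.2, Nat.prime_of_mem_primeFactors hp.1⟩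
    have hb : ∀ p ∈ P y, 0 ≤ f p - c * log p := by
      intro p hp
      obtain ⟨hpy, hpp⟩ := mem_P.1 hp
      have := le_f hpp.two_le
      have hp0 : (0 : ℝ) < p := by exact_mod_cast hpp.pos
      have hpy' : (p : ℝ) ≤ y := by exact_mod_cast hpy
      have h3 : log (p : ℝ) ≤ log (y + 1) := log_le_log hp0 (by linarith)
      have h4 : c * log p ≤ c * log (y + 1) := by gcongr
      have h5 : c * log (y + 1) = 1 / y := by rw [hc]; field_simp
      have h6 : 1 / (y : ℝ) ≤ 1 / p := one_div_le_one_div_of_le hp0 hpy'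
      linarith
    have hB : ∀ p ∈ N.primeFactors, ¬ p ≤ y → f p - c * log p ≤ 0 := by
      intro p hp hpy
      have hpp := Nat.prime_of_mem_primeFactors hp
      have := f_le hpp.two_le
      have hpy' : (y : ℝ) + 1 ≤ p := by exact_mod_cast (not_le.1 hpy)
      have h3 : log ((y : ℝ) + 1) ≤ log p := log_le_log (by linarith) hpy'
      have h4 : c * log (y + 1) ≤ c * log p := by gcongr
      have h5 : c * log (y + 1) = 1 / y := by rw [hc]; field_simp
      have h6 : 1 / ((p : ℝ) - 1) ≤ 1 / y := one_div_le_one_div_of_le (by linarith) (by linarith)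
      linarith
    calc _ ≤ ∑ p ∈ N.primeFactors.filter (· ≤ y), (f p - c * log p) := by
          rw [← Finset.sum_filter_add_sum_filter_not N.primeFactors (· ≤ y)]
          have : ∑ p ∈ N.primeFactors.filter (fun p => ¬ p ≤ y), (f p - c * log p) ≤ 0 := by
            apply Finset.sum_nonpos
            intro p hp
            rw [Finset.mem_filter] at hp
            exact hB p hp.1 hp.2
          linarith
      _ ≤ _ := Finset.sum_le_sum_of_subset_of_nonneg hs (fun p hp _ => hb p hp)
  rw [Finset.sum_sub_distrib, Finset.sum_sub_distrib, ← Finset.mul_sum, ← Finset.mul_sum] at h2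
  have h3 : (log N - ∑ p ∈ P y, log (p : ℝ)) / (y * log (y + 1))
      = c * log N - c * ∑ p ∈ P y, log (p : ℝ) := by
    rw [hc]; ring
  rw [h3]
  have := mul_le_mul_of_nonneg_left h1 hc0.le
  linarith

lemma P_succ_sum (g : ℕ → ℝ) (n : ℕ) :
    ∑ p ∈ P (n + 1), g p = ∑ p ∈ P n, g p + if (n + 1).Prime then g (n + 1) else 0 := by
  unfold P
  rw [Finset.sum_filter, Finset.sum_range_succ, ← Finset.sum_filter]

lemma log_fact_le (n : ℕ) (hn : 1 ≤ n) :
    log (n.factorial : ℝ) ≤ n * log n - n + 1 + log n := by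
  induction n, hn using Nat.le_induction with
  | base => simp
  | succ n hn ih =>
    have hn' : (1 : ℝ) ≤ n := by exact_mod_cast hn
    rw [Nat.factorial_succ]
    push_cast
    rw [log_mul (by positivity) (by positivity)]
    have h := one_sub_inv_le_log_of_pos (x := ((n : ℝ) + 1) / n) (by positivity)
    rw [log_div (by positivity) (by positivity)] at h
    have e : 1 - (((n : ℝ) + 1) / n)⁻¹ = 1 / (n + 1) := by
      field_simp
      ring
    rw [e, div_le_iff₀ (by positivity)] at h
    nlinarith

/-- Chebyshev-Mertens upper bound. -/
lemma mertens_upper (n : ℕ) (hn : 1 ≤ n) :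
    ∑ p ∈ P n, log (p : ℝ) / p ≤ log n - 1 + (1 + log n) / n + log 4 := by
  have hn' : (1 : ℝ) ≤ n := by exact_mod_cast hn
  have hth : ∑ p ∈ P n, log (p : ℝ) ≤ log 4 * n := by
    have h1 := Chebyshev.theta_le_log4_mul_x (x := n) (by positivity)
    rw [Chebyshev.theta_eq_sum_primesLE_log] at h1
    have : Nat.primesLE n = P n := by ext; simp [mem_P, Nat.mem_primesLE]
    rwa [this] at h1
  have hdvd : ∏ p ∈ P n, p ^ (n / p) ∣ n.factorial := by
    apply Finset.prod_dvd_of_isRelPrime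
    rotate_left
    · intro p hp
      have hpp := (mem_P.1 hp).2
      rw [hpp.pow_dvd_iff_le_factorization (Nat.factorial_ne_zero n)]
      rw [Nat.factorization_factorial hpp (Nat.lt_succ_self (Nat.log p n))]
      have h1 : 1 ∈ Finset.Ico 1 (Nat.log p n + 1) := by
        rw [Finset.mem_Ico]
        have := Nat.log_pos hpp.one_lt (mem_P.1 hp).1
        omega
      have := Finset.single_le_sum (f := fun i => n / p ^ i) (fun _ _ => Nat.zero_le _) h1
      simpa using this
    · intro p hp q hq hpq
      exact Nat.coprime_iff_isRelPrime.1 <| Nat.Coprime.pow _ _ ((Nat.coprime_primes (mem_P.1 hp).2 (mem_P.1 hq).2).2 hpq)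
  have hle : ∑ p ∈ P n, ((n / p : ℕ) : ℝ) * log p ≤ log (n.factorial : ℝ) := by
    have h1 : log ((∏ p ∈ P n, p ^ (n / p) : ℕ) : ℝ) ≤ log (n.factorial : ℝ) := by
      apply log_le_log
      · exact_mod_cast Nat.pos_of_dvd_of_pos hdvd (Nat.factorial_pos n)
      · exact_mod_cast Nat.le_of_dvd (Nat.factorial_pos n) hdvd
    push_cast at h1
    rw [log_prod] at h1
    · simpa [log_pow] using h1
    · intro p hp
      have := (mem_P.1 hp).2.pos
      positivity
  have hfl : ∑ p ∈ P n, (n : ℝ) * (log (p : ℝ) / p) ≤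
      ∑ p ∈ P n, (((n / p : ℕ) : ℝ) * log p + log p) := by
    apply Finset.sum_le_sum
    intro p hp
    have hpp := (mem_P.1 hp).2
    have hl : 0 ≤ log (p : ℝ) := log_natCast_nonneg p
    have h1 : (n : ℝ) / p ≤ ((n / p : ℕ) : ℝ) + 1 := by
      have := Nat.lt_floor_add_one ((n : ℝ) / p)
      rw [Nat.floor_div_eq_div] at this
      exact this.le
    calc (n : ℝ) * (log (p : ℝ) / p) = n / p * log p := by ring
      _ ≤ (((n / p : ℕ) : ℝ) + 1) * log p := by gcongr
      _ = _ := by ring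
  rw [← Finset.mul_sum, Finset.sum_add_distrib] at hfl
  have := log_fact_le n hn
  have h3 : (n : ℝ) * ∑ p ∈ P n, log (p : ℝ) / p ≤
      n * (log n - 1 + (1 + log n) / n + log 4) := by
    have : (n : ℝ) * (log n - 1 + (1 + log n) / n + log 4)
      = n * log n - n + (1 + log n) + n * log 4 := by field_simp
    linarith
  exact le_of_mul_le_mul_left h3 (by linarith)

lemma exp_le (p m : ℕ) (hm : m ≠ 0) {x : ℝ} (hx : 0 ≤ x)
    (h : (2.7182818286 : ℝ) ^ p ≤ x ^ m) : exp ((p : ℝ) / m) ≤ x := by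
  have hm' : (m : ℝ) ≠ 0 := by exact_mod_cast hm
  have h1 : exp ((p : ℝ) / m) ^ m = exp 1 ^ p := by
    rw [← exp_nat_mul, ← exp_nat_mul]
    congr 1
    field_simp
  have h2 : exp 1 ^ p ≤ (2.7182818286 : ℝ) ^ p := by
    have := exp_one_lt_d9
    gcongr
  exact le_of_pow_le_pow_left₀ hm hx (by rw [h1]; linarith)

lemma le_exp (p m : ℕ) (hm : m ≠ 0) {x : ℝ}
    (h : x ^ m ≤ (2.7182818283 : ℝ) ^ p) : x ≤ exp ((p : ℝ) / m) := by
  have hm' : (m : ℝ) ≠ 0 := by exact_mod_cast hm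
  have h1 : exp ((p : ℝ) / m) ^ m = exp 1 ^ p := by
    rw [← exp_nat_mul, ← exp_nat_mul]
    congr 1
    field_simp
  have h2 : (2.7182818283 : ℝ) ^ p ≤ exp 1 ^ p := by
    have := exp_one_gt_d9
    gcongr
  exact le_of_pow_le_pow_left₀ hm (exp_pos _).le (by rw [h1]; linarith)

lemma G_le (y a b : ℕ) (hb : 0 < b)
    (h : (∏ p ∈ P y, p) * b ≤ a * ∏ p ∈ P y, (p - 1)) :
    ∑ p ∈ P y, f p ≤ log ((a : ℝ) / b) := by
  have h1 : ∀ p ∈ P y, (0 : ℝ) < (p - 1 : ℕ) := by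
    intro p hp
    have := (mem_P.1 hp).2.two_le
    exact_mod_cast (by omega : 0 < p - 1)
  have h0 : ∀ p ∈ P y, (0 : ℝ) < p := by
    intro p hp
    exact_mod_cast (mem_P.1 hp).2.pos
  have e : ∑ p ∈ P y, f p = log (∏ p ∈ P y, ((p : ℝ) / (p - 1 : ℕ))) := by
    rw [log_prod]
    · apply Finset.sum_congr rfl
      intro p hp
      have hp0 := h0 p hp
      have hp1 := h1 p hp
      have h2 : ((p - 1 : ℕ) : ℝ) = p - 1 := by
        rw [Nat.cast_sub (mem_P.1 hp).2.one_le]; simp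
      rw [f, ← log_inv]
      congr 1
      rw [h2] at hp1 ⊢
      have := hp1.ne'
      field_simp
    · intro p hp
      exact (div_pos (h0 p hp) (h1 p hp)).ne'
  rw [e]
  apply log_le_log
  · exact Finset.prod_pos fun p hp => div_pos (h0 p hp) (h1 p hp)
  · rw [Finset.prod_div_distrib, div_le_div_iff₀ (Finset.prod_pos h1) (by exact_mod_cast hb), ← Nat.cast_prod, ← Nat.cast_prod]
    exact_mod_cast h

set_option maxRecDepth 100000 in
lemma G10 : ∑ p ∈ P 10, f p ≤ log ((4375 : ℕ) / (1000 : ℕ)) :=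
  G_le 10 4375 1000 (by norm_num) (by decide +kernel)

set_option maxRecDepth 100000 in
lemma G52 : ∑ p ∈ P 52, f p ≤ log ((721 : ℕ) / (100 : ℕ)) :=
  G_le 52 721 100 (by norm_num) (by decide +kernel)

set_option maxRecDepth 100000 in
lemma G330 : ∑ p ∈ P 330, f p ≤ log ((104 : ℕ) / (10 : ℕ)) :=
  G_le 330 104 10 (by norm_num) (by decide +kernel)

set_option maxRecDepth 100000 in
lemma B330_nat : 2 ^ 129850 ≤ ∏ p ∈ P 330, p ^ (20000 / p) := by decide +kernel

lemma B330 : (4.5 : ℝ) ≤ ∑ p ∈ P 330, log (p : ℝ) / p := by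
  have h1 : log ((2 ^ 129850 : ℕ) : ℝ) ≤ log ((∏ p ∈ P 330, p ^ (20000 / p) : ℕ) : ℝ) := by
    apply log_le_log
    · positivity
    · exact Nat.cast_le.2 B330_nat
  rw [Nat.cast_prod, log_prod] at h1
  · rw [Nat.cast_pow, log_pow] at h1
    have h2 : ∑ p ∈ P 330, log ((p ^ (20000 / p) : ℕ) : ℝ)
        ≤ ∑ p ∈ P 330, (20000 : ℝ) * (log (p : ℝ) / p) := by
      apply Finset.sum_le_sum
      intro p hp
      rw [Nat.cast_pow, log_pow]
      have hl : 0 ≤ log (p : ℝ) := log_natCast_nonneg p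
      have h3 : ((20000 / p : ℕ) : ℝ) ≤ 20000 / p := by
        simpa using Nat.cast_div_le (α := ℝ) (m := 20000) (n := p)
      calc _ ≤ (20000 : ℝ) / p * log p := by gcongr
        _ = _ := by ring
    rw [← Finset.mul_sum] at h2
    have := log_two_gt_d9
    push_cast at h1 h2
    linarith
  · intro p hp
    have := (mem_P.1 hp).2.pos
    positivity

lemma log330_le : log (330 : ℝ) ≤ 5.8 := by
  rw [log_le_iff_le_exp (by norm_num)]
  have := le_exp 58 10 (by norm_num) (x := 330) (by norm_num)
  norm_num at this ⊢
  exact this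

lemma le_log330 : (5.79 : ℝ) ≤ log 330 := by
  rw [le_log_iff_exp_le (by norm_num)]
  have := exp_le 579 100 (by norm_num) (x := 330) (by norm_num) (by norm_num)
  norm_num at this ⊢
  exact this

lemma mertens_c (n : ℕ) (hn : 330 ≤ n) :
    ∑ p ∈ P n, log (p : ℝ) / p ≤ log n + 0.41 := by
  have hn' : (330 : ℝ) ≤ n := by exact_mod_cast hn
  have h := mertens_upper n (by omega)
  have h4 : log (4 : ℝ) ≤ 1.38630 := by
    have : (4 : ℝ) = 2 ^ 2 := by norm_num
    rw [this, log_pow]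
    have := log_two_lt_d9
    norm_num at this ⊢
    linarith
  have h5 : (1 + log n) / n ≤ (0.0207 : ℝ) := by
    rw [div_le_iff₀ (by linarith)]
    have h6 := log_le_sub_one_of_pos (x := (n : ℝ) / 330) (by positivity)
    rw [log_div (by linarith) (by norm_num)] at h6
    have := log330_le
    linarith
  linarith

lemma G_tail (n : ℕ) (hn : 330 ≤ n) :
    ∑ p ∈ P n, f p ≤ ∑ p ∈ P 330, f p + log (log n) - log (log 330)
      + (∑ p ∈ P n, log (p : ℝ) / p - log n - 0.41) / log n
      + (log 330 + 0.41 - ∑ p ∈ P 330, log (p : ℝ) / p) / log 330 + (1 / 330 - 1 / (n : ℝ)) := by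
  induction n, hn using Nat.le_induction with
  | base =>
    apply le_of_eq
    push_cast
    ring
  | succ n hn ih =>
    have hn' : (330 : ℝ) ≤ n := by exact_mod_cast hn
    have hB := mertens_c n hn
    rw [P_succ_sum f n, P_succ_sum (fun p => log (p : ℝ) / p) n]
    set B := ∑ p ∈ P n, log (p : ℝ) / p
    set K := (log 330 + 0.41 - ∑ p ∈ P 330, log (p : ℝ) / p) / log 330
    have hcast : ((n + 1 : ℕ) : ℝ) = n + 1 := by push_cast; ring
    rw [hcast]
    set a := log (n : ℝ) with ha
    set b := log ((n : ℝ) + 1) with hb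
    have ha0 : 0 < a := log_pos (by linarith)
    have hab : a ≤ b := log_le_log (by linarith) (by linarith)
    have hb0 : 0 < b := by linarith
    have hlog : 1 - a / b ≤ log b - log a := by
      have := one_sub_inv_le_log_of_pos (x := b / a) (by positivity)
      rw [log_div hb0.ne' ha0.ne', inv_div] at this
      exact this
    have hstep : (if (n + 1).Prime then f (n + 1) else 0)
        ≤ (if (n + 1).Prime then b / ((n : ℝ) + 1) else 0) / b + (1 / n - 1 / ((n : ℝ) + 1)) := by
      have e : 1 / ((n : ℝ) + 1) + (1 / n - 1 / ((n : ℝ) + 1)) = 1 / n := by ring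
      split_ifs with h
      · have h1 := f_le h.two_le
        rw [hcast, add_sub_cancel_right] at h1
        have : b / ((n : ℝ) + 1) / b = 1 / (n + 1) := by field_simp
        rw [this]
        linarith
      · rw [zero_div, zero_add, sub_nonneg]
        exact one_div_le_one_div_of_le (by linarith) (by linarith)
    set d := (if (n + 1).Prime then b / ((n : ℝ) + 1) else 0)
    have hkey : (B - a - 0.41) / a ≤ log b - log a + (B - b - 0.41) / b := by
      have h1 : (B - a - 0.41) / a - (B - b - 0.41) / b = (B - 0.41) * (1 / a - 1 / b) := by
        field_simp
        ring
      have h2 : 0 ≤ 1 / a - 1 / b := by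
        rw [sub_nonneg]
        exact one_div_le_one_div_of_le ha0 hab
      have h3 : (B - 0.41) * (1 / a - 1 / b) ≤ a * (1 / a - 1 / b) := by
        gcongr
        linarith
      have h4 : a * (1 / a - 1 / b) = 1 - a / b := by
        field_simp
      linarith
    have e2 : (B + d - b - 0.41) / b = (B - b - 0.41) / b + d / b := by ring
    rw [e2]
    linarith

lemma piece (N y : ℕ) (hN : 0 < N) (hy : 2 ≤ y) (r th a b q t E l : ℝ) (hr : 0 < r)
    (hG : ∑ p ∈ P y, f p ≤ log r) (hth : th ≤ ∑ p ∈ P y, log (p : ℝ))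
    (ha : a ≤ log N) (hb : log N ≤ b) (hq : exp q ≤ a) (hE : exp t ≤ E)
    (hl : exp l ≤ y + 1) (ht : b - th ≤ t * (y * l)) (ht0 : 0 ≤ t) (h : r * E < 3 * q) :
    (N : ℝ) / N.totient < 3 * log (log N) := by
  have hA := keyA N y hN hy
  have hyR : (2 : ℝ) ≤ y := by exact_mod_cast hy
  have hl1 : l ≤ log (y + 1) := (le_log_iff_exp_le (by linarith)).2 hl
  have hlp : 0 < log ((y : ℝ) + 1) := log_pos (by linarith)
  have h1 : (log N - ∑ p ∈ P y, log (p : ℝ)) / (y * log (y + 1)) ≤ t := by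
    rw [div_le_iff₀ (by positivity)]
    have : t * (y * l) ≤ t * (y * log (y + 1)) := by gcongr
    linarith
  have hpos : 0 < (N : ℝ) / N.totient := by
    have := Nat.totient_pos.2 hN
    positivity
  have h2 : log ((N : ℝ) / N.totient) ≤ log r + t := by linarith
  have h3 : (N : ℝ) / N.totient ≤ r * exp t := by
    rw [log_le_iff_le_exp hpos, exp_add, exp_log hr] at h2
    exact h2
  have ha0 : 0 < a := lt_of_lt_of_le (exp_pos q) hq
  have h4 : q ≤ log (log N) := (le_log_iff_exp_le (by linarith)).2 (by linarith)
  have h5 : r * exp t ≤ r * E := by gcongr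
  linarith

lemma th_nonneg (y : ℕ) : 0 ≤ ∑ p ∈ P y, log (p : ℝ) :=
  Finset.sum_nonneg fun p _ => log_natCast_nonneg p

lemma tail (N : ℕ) (hN : 0 < N) (h : 1000 ≤ log (N : ℝ)) :
    (N : ℝ) / N.totient < 3 * log (log N) := by
  set n := ⌊log (N : ℝ)⌋₊ with hn
  have hn1 : 1000 ≤ n := Nat.le_floor (by exact_mod_cast h)
  have hn2 : (n : ℝ) ≤ log N := Nat.floor_le (by linarith)
  have hn3 : log N ≤ (n : ℝ) + 1 := (Nat.lt_floor_add_one _).le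
  have hnR : (1000 : ℝ) ≤ n := by exact_mod_cast hn1
  have hA := keyA N n hN (by omega)
  have hT := G_tail n (by omega)
  have hG := G330
  have hB := B330
  have hM := mertens_c n (by omega)
  have hl1 := log330_le
  have hl2 := le_log330
  have hlog : (6.9 : ℝ) ≤ log (n + 1) := by
    rw [le_log_iff_exp_le (by linarith)]
    have := exp_le 69 10 (by norm_num) (x := 1000) (by norm_num) (by norm_num)
    norm_num at this ⊢
    linarith
  have hlogn : 0 < log (n : ℝ) := log_pos (by linarith)
  have h1 : (log N - ∑ p ∈ P n, log (p : ℝ)) / (n * log (n + 1)) ≤ 0.1453 := by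
    rw [div_le_iff₀ (by positivity)]
    have := th_nonneg n
    have : 0.1453 * (n * 6.9) ≤ 0.1453 * (n * log ((n : ℝ) + 1)) := by gcongr
    linarith
  have h2 : (∑ p ∈ P n, log (p : ℝ) / p - log n - 0.41) / log n ≤ 0 :=
    div_nonpos_of_nonpos_of_nonneg (by linarith) hlogn.le
  have h3 : (log 330 + 0.41 - ∑ p ∈ P 330, log (p : ℝ) / p) / log 330 ≤ 0.295 := by
    rw [div_le_iff₀ (by linarith)]
    linarith
  have h4 : 0 ≤ 1 / (n : ℝ) := by positivity
  have h5 : log (5.79 : ℝ) ≤ log (log 330) := log_le_log (by norm_num) hl2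
  have h6 : log ((104 : ℕ) / (10 : ℕ) : ℝ) + 0.45 < log 3 + log 5.79 := by
    rw [← log_mul (by norm_num) (by norm_num), lt_log_iff_exp_lt (by norm_num), exp_add,
      exp_log (by norm_num)]
    have := exp_le 45 100 (by norm_num) (x := 1.6) (by norm_num) (by norm_num)
    norm_num at this ⊢
    linarith
  have hpos : 0 < (N : ℝ) / N.totient := by
    have := Nat.totient_pos.2 hN
    positivity
  have h7 : log ((N : ℝ) / N.totient) < log 3 + log (log n) := by
    have : (1 : ℝ) / 330 ≤ 0.0031 := by norm_num
    linarith
  rw [← log_mul (by norm_num) hlogn.ne'] at h7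
  have h8 := (log_lt_log_iff hpos (by positivity)).1 h7
  have h9 : log (n : ℝ) ≤ log (log N) := log_le_log (by linarith) hn2
  linarith

lemma th10 : (5.34 : ℝ) ≤ ∑ p ∈ P 10, log (p : ℝ) := by
  have hP : P 10 = {2, 3, 5, 7} := by decide +kernel
  have : ∑ p ∈ P 10, log (p : ℝ) = log 210 := by
    rw [← log_prod, hP]
    · norm_num
    · intro p hp
      have := (mem_P.1 hp).2.pos
      positivity
  rw [this, le_log_iff_exp_le (by norm_num)]
  have := exp_le 534 100 (by norm_num) (x := 210) (by norm_num) (by norm_num)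
  norm_num at this ⊢
  exact this

lemma big (N : ℕ) (hN : 210 ≤ N) : (N : ℝ) / N.totient < 3 * log (log N) := by
  have hN0 : 0 < N := by omega
  have h210 : (5.34 : ℝ) ≤ log N := by
    rw [le_log_iff_exp_le (by positivity)]
    have := exp_le 534 100 (by norm_num) (x := 210) (by norm_num) (by norm_num)
    have h2 : (210 : ℝ) ≤ N := by exact_mod_cast hN
    norm_num at this ⊢
    linarith
  rcases le_total (log (N : ℝ)) 8 with h1 | h1
  · exact piece N 10 hN0 (by norm_num) _ 5.34 5.34 8 ((167 : ℕ) / (100 : ℕ)) ((12 : ℕ) / (100 : ℕ)) 1.13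
      ((239 : ℕ) / (100 : ℕ)) (by norm_num) G10 th10 h210 h1
      (exp_le _ _ (by norm_num) (by norm_num) (by norm_num))
      (exp_le _ _ (by norm_num) (by norm_num) (by norm_num))
      (exp_le _ _ (by norm_num) (by norm_num) (by norm_num))
      (by norm_num) (by norm_num) (by norm_num)
  rcases le_total (log (N : ℝ)) 13 with h2 | h2
  · exact piece N 10 hN0 (by norm_num) _ 5.34 8 13 ((207 : ℕ) / (100 : ℕ)) ((33 : ℕ) / (100 : ℕ)) 1.4
      ((239 : ℕ) / (100 : ℕ)) (by norm_num) G10 th10 h1 h2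
      (exp_le _ _ (by norm_num) (by norm_num) (by norm_num))
      (exp_le _ _ (by norm_num) (by norm_num) (by norm_num))
      (exp_le _ _ (by norm_num) (by norm_num) (by norm_num))
      (by norm_num) (by norm_num) (by norm_num)
  rcases le_total (log (N : ℝ)) 18 with h3 | h3
  · exact piece N 10 hN0 (by norm_num) _ 5.34 13 18 ((256 : ℕ) / (100 : ℕ)) ((53 : ℕ) / (100 : ℕ)) 1.7
      ((239 : ℕ) / (100 : ℕ)) (by norm_num) G10 th10 h2 h3
      (exp_le _ _ (by norm_num) (by norm_num) (by norm_num))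
      (exp_le _ _ (by norm_num) (by norm_num) (by norm_num))
      (exp_le _ _ (by norm_num) (by norm_num) (by norm_num))
      (by norm_num) (by norm_num) (by norm_num)
  rcases le_total (log (N : ℝ)) 35 with h4 | h4
  · exact piece N 52 hN0 (by norm_num) _ 0 18 35 ((289 : ℕ) / (100 : ℕ)) ((17 : ℕ) / (100 : ℕ)) 1.19
      ((397 : ℕ) / (100 : ℕ)) (by norm_num) G52 (th_nonneg _) h3 h4
      (exp_le _ _ (by norm_num) (by norm_num) (by norm_num))
      (exp_le _ _ (by norm_num) (by norm_num) (by norm_num))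
      (exp_le _ _ (by norm_num) (by norm_num) (by norm_num))
      (by norm_num) (by norm_num) (by norm_num)
  rcases le_total (log (N : ℝ)) 75 with h5 | h5
  · exact piece N 52 hN0 (by norm_num) _ 0 35 75 ((355 : ℕ) / (100 : ℕ)) ((37 : ℕ) / (100 : ℕ)) 1.45
      ((397 : ℕ) / (100 : ℕ)) (by norm_num) G52 (th_nonneg _) h4 h5
      (exp_le _ _ (by norm_num) (by norm_num) (by norm_num))
      (exp_le _ _ (by norm_num) (by norm_num) (by norm_num))
      (exp_le _ _ (by norm_num) (by norm_num) (by norm_num))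
      (by norm_num) (by norm_num) (by norm_num)
  rcases le_total (log (N : ℝ)) 115 with h6 | h6
  · exact piece N 52 hN0 (by norm_num) _ 0 75 115 ((431 : ℕ) / (100 : ℕ)) ((56 : ℕ) / (100 : ℕ)) 1.76
      ((397 : ℕ) / (100 : ℕ)) (by norm_num) G52 (th_nonneg _) h5 h6
      (exp_le _ _ (by norm_num) (by norm_num) (by norm_num))
      (exp_le _ _ (by norm_num) (by norm_num) (by norm_num))
      (exp_le _ _ (by norm_num) (by norm_num) (by norm_num))
      (by norm_num) (by norm_num) (by norm_num)
  rcases le_total (log (N : ℝ)) 500 with h7 | h7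
  · exact piece N 330 hN0 (by norm_num) _ 0 115 500 ((474 : ℕ) / (100 : ℕ)) ((27 : ℕ) / (100 : ℕ)) 1.32
      ((58 : ℕ) / (10 : ℕ)) (by norm_num) G330 (th_nonneg _) h6 h7
      (exp_le _ _ (by norm_num) (by norm_num) (by norm_num))
      (exp_le _ _ (by norm_num) (by norm_num) (by norm_num))
      (exp_le _ _ (by norm_num) (by norm_num) (by norm_num))
      (by norm_num) (by norm_num) (by norm_num)
  rcases le_total (log (N : ℝ)) 1000 with h8 | h8
  · exact piece N 330 hN0 (by norm_num) _ 0 500 1000 ((62 : ℕ) / (10 : ℕ)) ((53 : ℕ) / (100 : ℕ)) 1.71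
      ((58 : ℕ) / (10 : ℕ)) (by norm_num) G330 (th_nonneg _) h7 h8
      (exp_le _ _ (by norm_num) (by norm_num) (by norm_num))
      (exp_le _ _ (by norm_num) (by norm_num) (by norm_num))
      (exp_le _ _ (by norm_num) (by norm_num) (by norm_num))
      (by norm_num) (by norm_num) (by norm_num)
  exact tail N hN0 h8

lemma loglog_ge (N : ℕ) {q a M : ℝ} (h1 : exp q ≤ a) (h2 : exp a ≤ M) (h3 : M ≤ N) :
    q ≤ log (log N) := by
  have hN : (0 : ℝ) < N := lt_of_lt_of_le (exp_pos a) (h2.trans h3)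
  have ha : a ≤ log N := (le_log_iff_exp_le hN).2 (h2.trans h3)
  have ha0 : 0 < a := lt_of_lt_of_le (exp_pos q) h1
  exact (le_log_iff_exp_le (by linarith)).2 (h1.trans ha)

lemma small_nat : ∀ N ∈ Finset.Ico 33 210, 4 * N ≤ 15 * Nat.totient N := by decide +kernel

lemma small (N : ℕ) (hN : 30 < N) (hN2 : N < 210) :
    (N : ℝ) / N.totient < 3 * log (log N) := by
  have ht : (0 : ℝ) < N.totient := by exact_mod_cast Nat.totient_pos.2 (by omega)
  rw [div_lt_iff₀ ht]
  by_cases h33 : 33 ≤ N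
  · have h1 : (4 : ℝ) * N ≤ 15 * N.totient := by
      exact_mod_cast small_nat N (by simp; omega)
    have h2 := loglog_ge N (q := (1251 : ℕ) / (1000 : ℕ)) (a := (3495 : ℕ) / (1000 : ℕ)) (M := 33)
      (exp_le _ _ (by norm_num) (by norm_num) (by norm_num))
      (exp_le _ _ (by norm_num) (by norm_num) (by norm_num)) (by exact_mod_cast h33)
    push_cast at h2
    nlinarith
  · have h1 : N ≤ 3 * Nat.totient N := by
      have : N = 31 ∨ N = 32 := by omega
      rcases this with rfl | rfl <;> decide +kernel
    have h1' : (N : ℝ) ≤ 3 * N.totient := by exact_mod_cast h1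
    have h2 := loglog_ge N (q := (12 : ℕ) / (10 : ℕ)) (a := (34 : ℕ) / (10 : ℕ)) (M := 30)
      (exp_le _ _ (by norm_num) (by norm_num) (by norm_num))
      (exp_le _ _ (by norm_num) (by norm_num) (by norm_num)) (by exact_mod_cast hN.le)
    push_cast at h2
    nlinarith

end TLB

/-- If `N > 30` is an integer, then `φ(N) > N / (3 log log N)`. -/
theorem totient_lower_bound (N : ℕ) (hN : 30 < N) :
    (N : ℝ) / (3 * Real.log (Real.log N)) < N.totient := by
  have ht : (0 : ℝ) < N.totient := by exact_mod_cast Nat.totient_pos.2 (by omega)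
  have h : (N : ℝ) / N.totient < 3 * Real.log (Real.log N) := by
    rcases lt_or_ge N 210 with h | h
    · exact TLB.small N hN h
    · exact TLB.big N h
  have hN0 : (0 : ℝ) < N := by exact_mod_cast (by omega : 0 < N)
  have hpos : 0 < 3 * Real.log (Real.log N) := lt_trans (div_pos hN0 ht) h
  rw [div_lt_iff₀ ht] at h
  rw [div_lt_iff₀ hpos]
  linarith
end

section
/- If D < 0 is an integer congruent to 0 or 1 modulo 4, then h(D) < (1/π) · √|D| · (2 + log |D|), where h(D) denotes the number of proper (SL₂(ℤ)-) equivalence classes of primitive positive definite integral binary quadratic forms of discriminant D. -/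
/-- `(a, b, c)` represents a primitive positive definite integral binary quadratic
form `aX² + bXY + cY²` of discriminant `D`: it has discriminant `b² - 4ac = D`,
is primitive (`gcd(a,b,c) = 1`) and positive definite (`a > 0`; together with
`D < 0`). -/
def IsPrimPosDefQF (D : ℤ) (f : ℤ × ℤ × ℤ) : Prop :=
  f.2.1 ^ 2 - 4 * f.1 * f.2.2 = D ∧ Int.gcd f.1 (Int.gcd f.2.1 f.2.2) = 1 ∧ 0 < f.1

/-- Proper equivalence of binary quadratic forms: `g` is obtained from `f` by the
change of variables given by a matrix `M = !![p, q; r, s] ∈ SL₂(ℤ)`, i.e.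
`g(X, Y) = f(pX + qY, rX + sY)`. -/
def QFProperEquiv (D : ℤ) (f g : { f : ℤ × ℤ × ℤ // IsPrimPosDefQF D f }) : Prop :=
  ∃ M : Matrix.SpecialLinearGroup (Fin 2) ℤ,
    g.1.1 = f.1.1 * (M.1 0 0) ^ 2 + f.1.2.1 * (M.1 0 0) * (M.1 1 0) +
        f.1.2.2 * (M.1 1 0) ^ 2 ∧
    g.1.2.1 = 2 * f.1.1 * (M.1 0 0) * (M.1 0 1) +
        f.1.2.1 * ((M.1 0 0) * (M.1 1 1) + (M.1 0 1) * (M.1 1 0)) +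
        2 * f.1.2.2 * (M.1 1 0) * (M.1 1 1) ∧
    g.1.2.2 = f.1.1 * (M.1 0 1) ^ 2 + f.1.2.1 * (M.1 0 1) * (M.1 1 1) +
        f.1.2.2 * (M.1 1 1) ^ 2

/-- `h(D)`: the number of proper equivalence classes of primitive positive definite
integral binary quadratic forms of discriminant `D`. -/
noncomputable def formClassNumber (D : ℤ) : ℕ :=
  Nat.card (Quot (QFProperEquiv D))

theorem aux_sq_dvd {g f s : ℕ} (hg : 0 < g) (hs : Squarefree s) (h : g ^ 2 ∣ f ^ 2 * s) : g ∣ f := by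
  obtain ⟨g', f', hc, hg', hf'⟩ := Nat.exists_coprime g f
  set d := Nat.gcd g f with hd
  have hdpos : 0 < d := Nat.gcd_pos_of_pos_left _ hg
  have h1 : g' ^ 2 ∣ f' ^ 2 * s := by
    rw [hg', hf'] at h
    have h2 : d ^ 2 * g' ^ 2 ∣ d ^ 2 * (f' ^ 2 * s) := by
      convert h using 1 <;> ring
    exact Nat.dvd_of_mul_dvd_mul_left (by positivity) h2
  have h2 : g' ^ 2 ∣ s := (Nat.Coprime.pow 2 2 hc).dvd_of_dvd_mul_left h1
  have h3 : g' = 1 := by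
    have := hs g' (by rw [← sq]; exact h2)
    simpa using this
  rw [hg', h3, one_mul]
  exact Nat.gcd_dvd_right _ _

/-- The encoding relation. -/
def EncRel (f : ℕ) (β : ℤ → ℤ) (a b : ℤ) (n t r : ℕ) : Prop :=
  ∃ (g e : ℕ) (b' x : ℤ), 0 < g ∧ 0 < e ∧ 0 < t ∧ n = g * e ∧ Nat.gcd n f = g ∧
    a = (g : ℤ) ^ 2 * e * t ∧ β a = g * b' ∧ b = g * b' + 2 * (g * x) ∧
    (t : ℤ) ∣ x ∧ (e : ℤ) ∣ x + b' ∧ IsCoprime (t : ℤ) (e : ℤ) ∧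
    (r : ℤ) = (x / ((e : ℤ) * t)) % g

theorem encRel_unique {f : ℕ} {β : ℤ → ℤ} {a₁ b₁ a₂ b₂ : ℤ} {n t r : ℕ}
    (h₁ : EncRel f β a₁ b₁ n t r) (h₂ : EncRel f β a₂ b₂ n t r)
    (l₁ : -a₁ < b₁) (u₁ : b₁ ≤ a₁) (l₂ : -a₂ < b₂) (u₂ : b₂ ≤ a₂) : a₁ = a₂ ∧ b₁ = b₂ := by
  obtain ⟨g, e, b', x, hg, he, ht, hn, hgf, ha, hb0, hb, htx, hex, hco, hr⟩ := h₁
  obtain ⟨g2, e2, bq, y, hg2, he2, ht2, hn2, hgf2, ha2, hb02, hb2, hty, hey, hco2, hr2⟩ := h₂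
  obtain rfl : g = g2 := by rw [← hgf, ← hgf2]
  obtain rfl : e = e2 := Nat.eq_of_mul_eq_mul_left hg (by rw [← hn, ← hn2])
  obtain rfl : a₁ = a₂ := by rw [ha, ha2]
  refine ⟨rfl, ?_⟩
  have hg0 : (g : ℤ) ≠ 0 := by positivity
  obtain rfl : b' = bq := mul_left_cancel₀ hg0 (by rw [← hb0, ← hb02])
  have d1 : (t : ℤ) * e ∣ x - y := by
    apply hco.mul_dvd (dvd_sub htx hty)
    have := dvd_sub hex hey
    simpa using this
  have hm : x % ((e : ℤ) * t) = y % ((e : ℤ) * t) := by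
    rw [mul_comm] at d1
    exact Int.emod_eq_emod_iff_emod_sub_eq_zero.mpr (Int.emod_eq_zero_of_dvd d1)
  have d2 : (g : ℤ) ∣ x / ((e : ℤ) * t) - y / ((e : ℤ) * t) :=
    Int.ModEq.dvd (show _ % _ = _ % _ by rw [← hr, ← hr2])
  obtain ⟨k, hk⟩ := d2
  have e1 := Int.mul_ediv_add_emod x ((e : ℤ) * t)
  have e2 := Int.mul_ediv_add_emod y ((e : ℤ) * t)
  have e3 : x - y = (e : ℤ) * t * (g * k) := by rw [← hk]; linear_combination -e1 + e2 + hm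
  have e4 : b₁ - b₂ = 2 * a₁ * k := by
    rw [hb, hb2, ha]; linear_combination 2 * (g : ℤ) * e3
  have hapos : 0 < a₁ := by rw [ha]; positivity
  have k1 : k < 1 := by
    by_contra hh
    push Not at hh
    nlinarith
  have k2 : -1 < k := by
    by_contra hh
    push Not at hh
    nlinarith
  have : k = 0 := by omega
  subst this
  linarith

theorem encRel_exists {D : ℤ} (hD : D ≠ 0) {f s : ℕ} (hf : f ^ 2 * s = D.natAbs)
    (hs : Squarefree s) {β : ℤ → ℤ} {a b : ℤ} (ha : 0 < a) (hb : 4 * a ∣ b ^ 2 - D)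
    (hβ : 4 * a ∣ β a ^ 2 - D) : ∃ n t r : ℕ, EncRel f β a b n t r ∧ 0 < n ∧ 0 < t ∧
      ((n * Nat.gcd n f * t : ℕ) : ℤ) = a ∧ r < Nat.gcd n f := by
  obtain ⟨s', g, hgs, hs'⟩ := Nat.sq_mul_squarefree (Nat.gcd a.natAbs D.natAbs)
  have hgpos : 0 < g := by
    rcases Nat.eq_zero_or_pos g with h | h
    · subst h
      have : Nat.gcd a.natAbs D.natAbs ≠ 0 := by
        intro h; rw [Nat.gcd_eq_zero_iff] at h; omega
      simp at hgs; omega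
    · exact h
  have hg0 : (g : ℤ) ≠ 0 := by positivity
  have hga : (g : ℤ) ^ 2 ∣ a := by
    have : g ^ 2 ∣ a.natAbs := (Dvd.intro _ hgs).trans (Nat.gcd_dvd_left _ _)
    have := Int.natCast_dvd.mpr this
    exact_mod_cast this
  have hgD' : g ^ 2 ∣ D.natAbs := (Dvd.intro _ hgs).trans (Nat.gcd_dvd_right _ _)
  have hgD : (g : ℤ) ^ 2 ∣ D := by
    have := Int.natCast_dvd.mpr hgD'
    exact_mod_cast this
  obtain ⟨a', rfl⟩ := hga
  obtain ⟨D', rfl⟩ := hgD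
  have ha' : 0 < a' := by
    by_contra h
    push Not at h
    have : (0:ℤ) < (g:ℤ)^2 := by positivity
    nlinarith
  have hsq : ∀ p : ℤ, p ^ 2 ∣ a' → p ^ 2 ∣ D' → IsUnit p := by
    intro p h1 h2
    have h3 : (g * p.natAbs) ^ 2 ∣ g ^ 2 * s' := by
      rw [hgs]
      apply Nat.dvd_gcd
      · rw [Int.natAbs_mul, Int.natAbs_pow, Int.natAbs_natCast, mul_pow, ← Int.natAbs_pow]
        exact Nat.mul_dvd_mul_left _ (Int.natAbs_dvd_natAbs.mpr h1)
      · rw [Int.natAbs_mul, Int.natAbs_pow, Int.natAbs_natCast, mul_pow, ← Int.natAbs_pow]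
        exact Nat.mul_dvd_mul_left _ (Int.natAbs_dvd_natAbs.mpr h2)
    rw [mul_pow] at h3
    have h4 := Nat.dvd_of_mul_dvd_mul_left (by positivity) h3
    have := hs' p.natAbs (by rw [← sq]; exact h4)
    rw [Int.isUnit_iff_natAbs_eq]
    simpa using this
  obtain ⟨k0, hk0⟩ := hβ
  obtain ⟨k1, hk1⟩ := hb
  have hgb0 : (g : ℤ) ∣ β (g ^ 2 * a') := by
    rw [← Int.pow_dvd_pow_iff two_ne_zero]
    exact ⟨D' + 4 * a' * k0, by linear_combination hk0⟩
  have hgb1 : (g : ℤ) ∣ b := by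
    rw [← Int.pow_dvd_pow_iff two_ne_zero]
    exact ⟨D' + 4 * a' * k1, by linear_combination hk1⟩
  obtain ⟨b', hb'⟩ := hgb0
  obtain ⟨bw, rfl⟩ := hgb1
  rw [hb'] at hk0
  have hg2 : (g : ℤ) ^ 2 ≠ 0 := by positivity
  have q0 : b' ^ 2 - D' = 4 * a' * k0 := mul_left_cancel₀ hg2 (by linear_combination hk0)
  have q1 : bw ^ 2 - D' = 4 * a' * k1 := mul_left_cancel₀ hg2 (by linear_combination hk1)
  have hpar : ∃ x, bw = b' + 2 * x := by
    have h1 : Even (bw ^ 2 - b' ^ 2) := ⟨2 * a' * (k1 - k0), by linear_combination q1 - q0⟩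
    have h2 : Even (bw - b') := by
      rw [Int.even_sub] at h1 ⊢
      simpa [Int.even_pow] using h1
    obtain ⟨x, hx⟩ := h2
    exact ⟨x, by linarith⟩
  obtain ⟨x, rfl⟩ := hpar
  have hx : x * (x + b') = a' * (k1 - k0) := by linarith
  set t : ℕ := Int.gcd x a' with htdef
  have htpos : 0 < t := Int.gcd_pos_of_ne_zero_right _ ha'.ne'
  have ht0 : (t : ℤ) ≠ 0 := by positivity
  obtain ⟨y, hy⟩ : (t : ℤ) ∣ x := Int.gcd_dvd_left ..
  obtain ⟨e', he'⟩ : (t : ℤ) ∣ a' := Int.gcd_dvd_right ..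
  have he'pos : 0 < e' := by
    by_contra h
    push Not at h
    have : (0:ℤ) < t := by positivity
    nlinarith
  lift e' to ℕ using he'pos.le with e
  have hepos : 0 < e := by exact_mod_cast he'pos
  have hye : IsCoprime y (e : ℤ) := by
    rw [Int.isCoprime_iff_gcd_eq_one]
    have : t * Int.gcd y e = t * 1 := by
      conv_rhs => rw [htdef, hy, he', Int.gcd_mul_left]
      simp
    exact Nat.eq_of_mul_eq_mul_left htpos this
  have hex : (e : ℤ) ∣ x + b' := by
    have : (e : ℤ) ∣ y * (x + b') := ⟨k1 - k0, mul_left_cancel₀ ht0 (by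
      rw [he'] at hx
      nth_rewrite 1 [hy] at hx
      linear_combination hx)⟩
    exact hye.symm.dvd_of_dvd_mul_left this
  have htx : (t : ℤ) ∣ x := ⟨y, hy⟩
  have hte : IsCoprime (t : ℤ) (e : ℤ) := by
    have h0 : ((Int.gcd t e : ℕ) : ℤ) ∣ t := Int.gcd_dvd_left ..
    have h1 : ((Int.gcd t e : ℕ) : ℤ) ∣ e := Int.gcd_dvd_right ..
    rw [Int.isCoprime_iff_gcd_eq_one]
    set p : ℕ := Int.gcd t e
    have h2 : (p : ℤ) ∣ b' := (dvd_add_right (h0.trans htx)).mp (h1.trans hex)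
    have h3 : (p : ℤ) ^ 2 ∣ a' := by rw [he', sq]; exact mul_dvd_mul h0 h1
    have h4 : (p : ℤ) ^ 2 ∣ D' := by
      have : D' = b' ^ 2 - a' * (4 * k0) := by linear_combination -q0
      rw [this]
      exact dvd_sub (pow_dvd_pow_of_dvd h2 2) (h3.mul_right _)
    simpa using Int.isUnit_iff_natAbs_eq.mp (hsq _ h3 h4)
  have heD : ∀ p : ℕ, p.Prime → p ∣ e → ¬ ((p : ℤ) ∣ D') := by
    intro p hp hpe hpD
    have hpp : Prime (p : ℤ) := Nat.prime_iff_prime_int.mp hp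
    have hpe' : (p : ℤ) ∣ e := by exact_mod_cast hpe
    have hpa : (p : ℤ) ∣ a' := by rw [he']; exact hpe'.mul_left _
    have hpb : (p : ℤ) ∣ b' := by
      apply hpp.dvd_of_dvd_pow (n := 2)
      have : b' ^ 2 = D' + a' * (4 * k0) := by linear_combination q0
      rw [this]
      exact dvd_add hpD (hpa.mul_right _)
    have hpx : (p : ℤ) ∣ x := (dvd_add_left hpb).mp (hpe'.trans hex)
    have hpt : (p : ℤ) ∣ t := Int.dvd_coe_gcd hpx hpa
    exact hpp.not_isUnit (hte.isUnit_of_dvd' hpt hpe')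
  have hgf : g ∣ f := aux_sq_dvd hgpos hs (by rw [hf]; exact hgD')
  obtain ⟨f', rfl⟩ := hgf
  have hfD : f' ∣ D'.natAbs := by
    rw [Int.natAbs_mul, Int.natAbs_pow, Int.natAbs_natCast] at hf
    have : f' ^ 2 * s = D'.natAbs :=
      Nat.eq_of_mul_eq_mul_left (show 0 < g ^ 2 by positivity) (by rw [← hf]; ring)
    rw [← this]
    exact (dvd_pow_self _ two_ne_zero).mul_right _
  have hcop : Nat.Coprime e f' := by
    apply Nat.coprime_of_dvd
    intro p hp h1 h2
    exact heD p hp h1 (Int.natCast_dvd.mpr (h2.trans hfD))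
  have hgcd : Nat.gcd (g * e) (g * f') = g := by
    rw [Nat.gcd_mul_left, hcop, mul_one]
  have hrnn : 0 ≤ (x / ((e : ℤ) * t)) % g := Int.emod_nonneg _ hg0
  have hrlt : (x / ((e : ℤ) * t)) % g < g := Int.emod_lt_of_pos _ (by positivity)
  refine ⟨g * e, t, ((x / ((e : ℤ) * t)) % g).toNat, ⟨g, e, b', x, hgpos, hepos, htpos, rfl,
    hgcd, by rw [he']; ring, hb', by ring, htx, hex, hte, by rw [Int.toNat_of_nonneg hrnn]⟩,
    by positivity, htpos, ?_, ?_⟩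
  · rw [hgcd, he']; push_cast; ring
  · rw [hgcd]; omega

/-- Reduced pairs `(a, b)`. -/
def RedPair (D : ℤ) (A : ℕ) (q : ℤ × ℤ) : Prop :=
  0 < q.1 ∧ q.1 ≤ A ∧ -q.1 < q.2 ∧ q.2 ≤ q.1 ∧ 4 * q.1 ∣ q.2 ^ 2 - D

theorem redPair_finite (D : ℤ) (A : ℕ) : {q | RedPair D A q}.Finite := by
  apply (Set.finite_Icc ((-A, -A) : ℤ × ℤ) (A, A)).subset
  rintro ⟨a, b⟩ ⟨h1, h2, h3, h4, -⟩
  simp only [Set.mem_Icc, Prod.mk_le_mk]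
  simp only at *
  refine ⟨⟨?_, ?_⟩, ?_, ?_⟩ <;> linarith

theorem redPair_card {D : ℤ} (hD : D ≠ 0) (A : ℕ) :
    ((Nat.card {q // RedPair D A q} : ℕ) : ℝ) ≤ A * ∑ n ∈ Finset.Icc 1 A, (n : ℝ)⁻¹ := by
  classical
  obtain ⟨s, f, hf, hs⟩ := Nat.sq_mul_squarefree D.natAbs
  let β : ℤ → ℤ := fun a => if h : ∃ b, 4 * a ∣ b ^ 2 - D then h.choose else 0
  have hβ : ∀ a b : ℤ, 4 * a ∣ b ^ 2 - D → 4 * a ∣ β a ^ 2 - D := by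
    intro a b h
    have h' : ∃ b, 4 * a ∣ b ^ 2 - D := ⟨b, h⟩
    simp only [β, dif_pos h']
    exact h'.choose_spec
  have hex : ∀ q : {q // RedPair D A q}, ∃ u : ℕ × ℕ × ℕ, EncRel f β q.1.1 q.1.2 u.1 u.2.1 u.2.2 ∧
      0 < u.1 ∧ 0 < u.2.1 ∧ ((u.1 * Nat.gcd u.1 f * u.2.1 : ℕ) : ℤ) = q.1.1 ∧
      u.2.2 < Nat.gcd u.1 f := by
    rintro ⟨⟨a, b⟩, h1, h2, h3, h4, h5⟩
    obtain ⟨n, t, r, h⟩ := encRel_exists hD hf hs h1 h5 (hβ _ _ h5)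
    exact ⟨(n, t, r), h⟩
  choose φ hφ using hex
  let T : Finset (Σ _ : ℕ, ℕ × ℕ) := (Finset.Icc 1 A).sigma fun n =>
    Finset.Icc 1 (A / (n * Nat.gcd n f)) ×ˢ Finset.range (Nat.gcd n f)
  have hT : ∀ q, (⟨(φ q).1, (φ q).2⟩ : Σ _ : ℕ, ℕ × ℕ) ∈ T := by
    intro q
    obtain ⟨-, h1, h2, h3, h4⟩ := hφ q
    have hA : (φ q).1 * Nat.gcd (φ q).1 f * (φ q).2.1 ≤ A := by
      have := q.2.2.1
      rw [← h3] at this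
      exact_mod_cast this
    have hg : 0 < Nat.gcd (φ q).1 f := Nat.gcd_pos_of_pos_left _ h1
    simp only [T, Finset.mem_sigma, Finset.mem_product, Finset.mem_Icc, Finset.mem_range]
    refine ⟨⟨h1, ?_⟩, ⟨h2, ?_⟩, h4⟩
    · calc (φ q).1 ≤ (φ q).1 * (Nat.gcd (φ q).1 f * (φ q).2.1) :=
            Nat.le_mul_of_pos_right _ (by positivity)
        _ ≤ A := by rw [← mul_assoc]; exact hA
    · rw [Nat.le_div_iff_mul_le (by positivity), mul_comm]; exact hA
  have hinj : Function.Injective fun q => (⟨⟨(φ q).1, (φ q).2⟩, hT q⟩ : T) := by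
    intro q q' h
    simp only [Subtype.mk.injEq, Sigma.mk.injEq, heq_eq_eq] at h
    obtain ⟨e1, e2⟩ := h
    have h1 := (hφ q).1
    have h2 := (hφ q').1
    rw [e1, e2] at h1
    have := encRel_unique h1 h2 q.2.2.2.1 q.2.2.2.2.1 q'.2.2.2.1 q'.2.2.2.2.1
    exact Subtype.ext (Prod.ext this.1 this.2)
  have hc : Nat.card {q // RedPair D A q} ≤ T.card := by
    have := Nat.card_le_card_of_injective _ hinj
    simpa using this
  calc ((Nat.card {q // RedPair D A q} : ℕ) : ℝ) ≤ T.card := by exact_mod_cast hc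
    _ = ∑ n ∈ Finset.Icc 1 A, (((A / (n * Nat.gcd n f) : ℕ) : ℝ) * (Nat.gcd n f : ℕ)) := by
      simp [T, Finset.card_sigma]
    _ ≤ ∑ n ∈ Finset.Icc 1 A, (A : ℝ) * (n : ℝ)⁻¹ := by
      apply Finset.sum_le_sum
      intro n hn
      have hn1 : 0 < n := (Finset.mem_Icc.mp hn).1
      have hg : 0 < Nat.gcd n f := Nat.gcd_pos_of_pos_left _ hn1
      have h1 : ((A / (n * Nat.gcd n f) : ℕ) : ℝ) ≤ (A : ℝ) / ((n * Nat.gcd n f : ℕ) : ℝ) :=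
        Nat.cast_div_le
      have hn' : (0:ℝ) < n := by exact_mod_cast hn1
      have hg' : (0:ℝ) < (Nat.gcd n f : ℕ) := by exact_mod_cast hg
      calc _ ≤ (A : ℝ) / ((n * Nat.gcd n f : ℕ) : ℝ) * (Nat.gcd n f : ℕ) := by gcongr
        _ = _ := by push_cast; field_simp
    _ = _ := by rw [Finset.mul_sum]

/-- Every class contains a reduced form. -/
theorem exists_reduced {D : ℤ} (hD : D < 0) (m : ℕ) :
    ∀ F : { f : ℤ × ℤ × ℤ // IsPrimPosDefQF D f }, F.1.1 ≤ m →
    ∃ G : { f : ℤ × ℤ × ℤ // IsPrimPosDefQF D f },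
      Quot.mk (QFProperEquiv D) F = Quot.mk (QFProperEquiv D) G ∧
      -G.1.1 < G.1.2.1 ∧ G.1.2.1 ≤ G.1.1 ∧ G.1.1 ≤ G.1.2.2 := by
  induction m with
  | zero =>
    intro F h
    have := F.2.2.2
    push_cast at h
    omega
  | succ m ih =>
    rintro ⟨⟨a, b, c⟩, hdisc, hprim, hpos⟩ hm
    simp only at hdisc hprim hpos hm
    have key : ∃ k : ℤ, -a < b + 2 * a * k ∧ b + 2 * a * k ≤ a := by
      refine ⟨-((b + a - 1) / (2 * a)), ?_, ?_⟩
      · have := Int.mul_ediv_add_emod (b + a - 1) (2 * a)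
        have h2 := Int.emod_nonneg (b + a - 1) (show 2 * a ≠ 0 by omega)
        linarith
      · have := Int.mul_ediv_add_emod (b + a - 1) (2 * a)
        have h2 := Int.emod_lt_of_pos (b + a - 1) (show 0 < 2 * a by omega)
        linarith
    obtain ⟨k, hk1, hk2⟩ := key
    have hgcd : ∀ p q r p' q' r' : ℤ, (∀ d : ℤ, d ∣ p' → d ∣ q' → d ∣ r' → d ∣ p ∧ d ∣ q ∧ d ∣ r) →
        Int.gcd p (Int.gcd q r) = 1 → Int.gcd p' (Int.gcd q' r') = 1 := by
      intro p q r p' q' r' h h1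
      set d := Int.gcd p' (Int.gcd q' r')
      have d1 : (d : ℤ) ∣ p' := Int.gcd_dvd_left ..
      have d2 : (d : ℤ) ∣ (Int.gcd q' r' : ℕ) := Int.gcd_dvd_right ..
      have d3 : (d : ℤ) ∣ q' := d2.trans (Int.gcd_dvd_left ..)
      have d4 : (d : ℤ) ∣ r' := d2.trans (Int.gcd_dvd_right ..)
      obtain ⟨x1, x2, x3⟩ := h d d1 d3 d4
      have := Int.dvd_coe_gcd x1 (Int.dvd_coe_gcd x2 x3)
      rw [h1] at this
      have := Int.natCast_dvd_natCast.mp this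
      exact Nat.dvd_one.mp this
    set b₁ := b + 2 * a * k with hb₁
    set c₁ := a * k ^ 2 + b * k + c with hc₁
    have hd1 : b₁ ^ 2 - 4 * a * c₁ = D := by rw [← hdisc, hb₁, hc₁]; ring
    have hp1 : Int.gcd a (Int.gcd b₁ c₁) = 1 := by
      refine hgcd a b c a b₁ c₁ ?_ hprim
      intro d h1 h2 h3
      have h4 : d ∣ b := by
        have : b = b₁ - a * (2 * k) := by rw [hb₁]; ring
        rw [this]; exact dvd_sub h2 (h1.mul_right _)
      refine ⟨h1, h4, ?_⟩
      have : c = c₁ - a * k ^ 2 - b * k := by rw [hc₁]; ring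
      rw [this]
      exact dvd_sub (dvd_sub h3 (h1.mul_right _)) (h4.mul_right _)
    let F₁ : { f : ℤ × ℤ × ℤ // IsPrimPosDefQF D f } := ⟨(a, b₁, c₁), hd1, hp1, hpos⟩
    have hF₁ : Quot.mk (QFProperEquiv D) ⟨(a, b, c), hdisc, hprim, hpos⟩ =
        Quot.mk (QFProperEquiv D) F₁ := by
      apply Quot.sound
      refine ⟨⟨!![1, k; 0, 1], by simp [Matrix.det_fin_two]⟩, ?_, ?_, ?_⟩ <;>
        simp [F₁, hb₁, hc₁] <;> ring
    by_cases hac : a ≤ c₁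
    · exact ⟨F₁, hF₁, hk1, hk2, hac⟩
    · push Not at hac
      have hc₁pos : 0 < c₁ := by
        by_contra h
        push Not at h
        nlinarith [sq_nonneg b₁, mul_nonneg hpos.le (neg_nonneg.mpr h)]
      have hd2 : (-b₁) ^ 2 - 4 * c₁ * a = D := by rw [← hd1]; ring
      have hp2 : Int.gcd c₁ (Int.gcd (-b₁) a) = 1 := by
        refine hgcd a b₁ c₁ _ _ _ ?_ hp1
        intro d h1 h2 h3
        exact ⟨h3, (dvd_neg.mp h2), h1⟩
      let F₂ : { f : ℤ × ℤ × ℤ // IsPrimPosDefQF D f } := ⟨(c₁, -b₁, a), hd2, hp2, hc₁pos⟩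
      have hF₂ : Quot.mk (QFProperEquiv D) F₁ = Quot.mk (QFProperEquiv D) F₂ := by
        apply Quot.sound
        refine ⟨⟨!![0, -1; 1, 0], by simp [Matrix.det_fin_two]⟩, ?_, ?_, ?_⟩ <;>
          simp [F₁, F₂]
      obtain ⟨G, hG, hG'⟩ := ih F₂ (by
        show c₁ ≤ (m : ℤ)
        push_cast at hm
        omega)
      exact ⟨G, hF₁.trans (hF₂.trans hG), hG'⟩

theorem formClassNumber_le {D : ℤ} (hD : D < 0) (A : ℕ)
    (hA : ∀ a : ℤ, 0 < a → 3 * a ^ 2 ≤ -D → a ≤ A) :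
    formClassNumber D ≤ Nat.card {q // RedPair D A q} := by
  classical
  have hex : ∀ c : Quot (QFProperEquiv D), ∃ G : { f : ℤ × ℤ × ℤ // IsPrimPosDefQF D f },
      c = Quot.mk (QFProperEquiv D) G ∧
      -G.1.1 < G.1.2.1 ∧ G.1.2.1 ≤ G.1.1 ∧ G.1.1 ≤ G.1.2.2 := by
    intro c
    induction c using Quot.ind with
    | mk F => exact exists_reduced hD F.1.1.toNat F (Int.self_le_toNat _)
  choose G hG using hex
  have hred : ∀ c, RedPair D A ((G c).1.1, (G c).1.2.1) := by
    intro c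
    obtain ⟨-, h1, h2, h3⟩ := hG c
    obtain ⟨hd, -, hpos⟩ := (G c).2
    refine ⟨hpos, hA _ hpos ?_, h1, h2, ⟨(G c).1.2.2, by linarith⟩⟩
    nlinarith
  have hfin : Finite {q // RedPair D A q} := (redPair_finite D A).to_subtype
  apply Nat.card_le_card_of_injective (fun c => (⟨_, hred c⟩ : {q // RedPair D A q}))
  intro c c' h
  simp only [Subtype.mk.injEq, Prod.mk.injEq] at h
  obtain ⟨e1, e2⟩ := h
  obtain ⟨hd, -, hpos⟩ := (G c).2
  obtain ⟨hd', -, hpos'⟩ := (G c').2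
  have e3 : (G c).1.2.2 = (G c').1.2.2 := by
    rw [← e1, ← e2] at hd'
    have : 4 * (G c).1.1 * (G c).1.2.2 = 4 * (G c).1.1 * (G c').1.2.2 := by linarith
    exact mul_left_cancel₀ (by omega) this
  rw [(hG c).1, (hG c').1]
  congr 1
  exact Subtype.ext (Prod.ext e1 (Prod.ext e2 e3))

/-- If `D < 0` is an integer congruent to `0` or `1` modulo `4`,
then `h(D) < (1/π) √|D| (2 + log |D|)`. -/
theorem formClassNumber_bound (D : ℤ) (hD : D < 0) (hcong : D % 4 = 0 ∨ D % 4 = 1) :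
    (formClassNumber D : ℝ) <
      (1 / Real.pi) * Real.sqrt |(D : ℝ)| * (2 + Real.log |(D : ℝ)|) := by
  set X : ℝ := |(D : ℝ)| with hX
  have hX' : X = -(D : ℝ) := abs_of_neg (by exact_mod_cast hD)
  have hX3 : 3 ≤ X := by
    have : D ≤ -3 := by omega
    have : (D : ℝ) ≤ -3 := by exact_mod_cast this
    linarith
  set A : ℕ := ⌊Real.sqrt (X / 3)⌋₊ with hAdef
  have hA : ∀ a : ℤ, 0 < a → 3 * a ^ 2 ≤ -D → a ≤ A := by
    intro a ha h
    lift a to ℕ using ha.le with n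
    have h' : 3 * (n : ℝ) ^ 2 ≤ X := by rw [hX']; exact_mod_cast h
    have : n ≤ A := Nat.le_floor (Real.le_sqrt_of_sq_le (by linarith))
    exact_mod_cast this
  have h1 : (formClassNumber D : ℝ) ≤ A * ∑ n ∈ Finset.Icc 1 A, (n : ℝ)⁻¹ :=
    le_trans (by exact_mod_cast formClassNumber_le hD A hA) (redPair_card hD.ne A)
  have h2 : ∑ n ∈ Finset.Icc 1 A, (n : ℝ)⁻¹ ≤ 1 + Real.log A := by
    have := harmonic_le_one_add_log A
    rw [harmonic_eq_sum_Icc] at this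
    push_cast at this
    exact this
  have hA1 : 1 ≤ A := Nat.le_floor (by
    rw [Nat.cast_one]; exact Real.le_sqrt_of_sq_le (by linarith))
  have hA1' : (1 : ℝ) ≤ A := by exact_mod_cast hA1
  have hAs : (A : ℝ) ≤ Real.sqrt (X / 3) := Nat.floor_le (Real.sqrt_nonneg _)
  have hsX : 0 < Real.sqrt X := Real.sqrt_pos.mpr (by linarith)
  have hlogA : Real.log A ≤ Real.log X / 2 := by
    rw [← Real.log_sqrt (by linarith)]
    apply Real.log_le_log (by linarith)
    exact hAs.trans (Real.sqrt_le_sqrt (by linarith))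
  have hlogX : 0 ≤ Real.log X := Real.log_nonneg (by linarith)
  have hlogA0 : 0 ≤ Real.log A := Real.log_nonneg hA1'
  have hs3 : Real.sqrt (X / 3) < 2 / Real.pi * Real.sqrt X := by
    have hpi := Real.pi_pos
    have hpi2 := Real.pi_lt_d2
    rw [Real.sqrt_lt' (by positivity), mul_pow, Real.sq_sqrt (by linarith), div_pow]
    rw [div_mul_eq_mul_div, div_lt_div_iff₀ (by norm_num) (by positivity)]
    have hp : Real.pi ^ 2 < 12 := by norm_num at hpi2; nlinarith
    nlinarith
  calc (formClassNumber D : ℝ) ≤ A * (1 + Real.log A) := h1.trans (by gcongr)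
    _ ≤ Real.sqrt (X / 3) * (1 + Real.log X / 2) := by gcongr
    _ < 2 / Real.pi * Real.sqrt X * (1 + Real.log X / 2) := by
      apply mul_lt_mul_of_pos_right hs3; linarith
    _ = _ := by ring
end
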